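/- Let m ≥ 3 be an odd integer, n ≥ 4 an even integer, and set S = 2(mn+1). Let x : {1,…,m}×{1,…,n} → {1,…,mn} be a bijection, and for 1 ≤ j ≤ n/2 − 1 set a_j = x_{1,j} + x_{1,j+1}. Then x is a C₄-face-magic Klein bottle labeling on 𝒦_{m,n} if and only if all of the following hold: (i) x_{2i−1,j} + x_{2i−1,j+1} = a_j for all 1 ≤ i ≤ (m+1)/2 and 1 ≤ j ≤ n/2 − 1; (ii) x_{2i−1,n+1−j} = S/2 − x_{2i−1,j} for all 1 ≤ i ≤ (m+1)/2 and 1 ≤ j ≤ n/2; (iii) x_{2i,n−j} + x_{2i,n−j+1} = a_j for all 1 ≤ i ≤ (m−1)/2 and 1 ≤ j ≤ n/2 − 1; (iv) x_{2i,j} = S/2 − x_{2i,n+1−j} for all 1 ≤ i ≤ (m−1)/2 and 1 ≤ j ≤ n/2. -/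

import Mathlib

/-- Reduction of a (positive) index modulo `n` to a representative in `{1, …, n}`. -/
def wrap (n j : ℕ) : ℕ := if j % n = 0 then n else j % n

/-- `x` is a C₄-face-magic Klein bottle labeling of the `m × n` Klein bottle grid graph
`𝒦_{m,n}` with C₄-face-magic value `S`: `x` is a bijection from `{1,…,m} × {1,…,n}`
onto `{1,…,m*n}` and every C₄-face of the natural embedding of `𝒦_{m,n}` in the Klein
bottle has vertex-label sum `S`. -/
def IsC4FaceMagic (m n : ℕ) (x : ℕ × ℕ → ℕ) (S : ℕ) : Prop :=
  Set.BijOn x (Set.Icc 1 m ×ˢ Set.Icc 1 n) (Set.Icc 1 (m * n)) ∧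
  (∀ i j, 1 ≤ i → i + 1 ≤ m → 1 ≤ j → j ≤ n →
    x (i, j) + x (i + 1, j) + x (i, wrap n (j + 1)) + x (i + 1, wrap n (j + 1)) = S) ∧
  (∀ j, 1 ≤ j → j ≤ n →
    x (m, j) + x (m, wrap n (j + 1)) + x (1, n + 1 - j) + x (1, wrap n (n - j)) = S)

lemma wrap_of_pos_of_le {n j : ℕ} (hj : 1 ≤ j) (hjn : j ≤ n) : wrap n j = j := by
  unfold wrap
  rcases hjn.eq_or_lt with rfl | h
  · simp
  · rw [Nat.mod_eq_of_lt h, if_neg (by omega)]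

lemma wrap_succ_self {n : ℕ} (hn : 2 ≤ n) : wrap n (n + 1) = 1 := by
  unfold wrap
  rw [Nat.add_mod_left, Nat.mod_eq_of_lt (by omega : 1 < n), if_neg one_ne_zero]

lemma wrap_zero (n : ℕ) : wrap n 0 = n := by
  simp [wrap]

/-- The face conditions of a C₄-face-magic labeling with the faces crossing the seam
between the columns `n` and `1` listed separately. -/
lemma isC4FaceMagic_iff {m n : ℕ} (hn : 2 ≤ n) {x : ℕ × ℕ → ℕ} {S : ℕ}
    (hbij : Set.BijOn x (Set.Icc 1 m ×ˢ Set.Icc 1 n) (Set.Icc 1 (m * n))) :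
    IsC4FaceMagic m n x S ↔
      (∀ i j, 1 ≤ i → i + 1 ≤ m → 1 ≤ j → j < n →
        x (i, j) + x (i + 1, j) + x (i, j + 1) + x (i + 1, j + 1) = S) ∧
      (∀ i, 1 ≤ i → i + 1 ≤ m → x (i, n) + x (i + 1, n) + x (i, 1) + x (i + 1, 1) = S) ∧
      (∀ j, 1 ≤ j → j < n →
        x (m, j) + x (m, j + 1) + x (1, n + 1 - j) + x (1, n - j) = S) ∧
      x (m, n) + x (m, 1) + x (1, 1) + x (1, n) = S := by
  constructor
  · rintro ⟨-, hface, hseam⟩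
    refine ⟨fun i j hi him hj hjn => ?_, fun i hi him => ?_, fun j hj hjn => ?_, ?_⟩
    · simpa [wrap_of_pos_of_le (show 1 ≤ j + 1 by omega) hjn] using hface i j hi him hj hjn.le
    · simpa [wrap_succ_self hn] using hface i n hi him (by omega) le_rfl
    · simpa [wrap_of_pos_of_le (show 1 ≤ j + 1 by omega) hjn,
        wrap_of_pos_of_le (show 1 ≤ n - j by omega) (Nat.sub_le n j)] using hseam j hj hjn.le
    · simpa [wrap_succ_self hn, wrap_zero] using hseam n (by omega) le_rfl
  · rintro ⟨hface, hface', hseam, hseam'⟩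
    refine ⟨hbij, fun i j hi him hj hjn => ?_, fun j hj hjn => ?_⟩
    · rcases hjn.eq_or_lt with rfl | hlt
      · simpa [wrap_succ_self hn] using hface' i hi him
      · simpa [wrap_of_pos_of_le (show 1 ≤ j + 1 by omega) hlt] using hface i j hi him hj hlt
    · rcases hjn.eq_or_lt with rfl | hlt
      · simpa [wrap_succ_self hn, wrap_zero] using hseam'
      · simpa [wrap_of_pos_of_le (show 1 ≤ j + 1 by omega) hlt,
          wrap_of_pos_of_le (show 1 ≤ n - j by omega) (Nat.sub_le n j)] using hseam j hj hlt

/-- If opposite pairs of neighbours in a row sum to `2 * T` and the two ends sum to `T`,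
then all pairs of opposite entries sum to `T`. -/
lemma add_reflect_eq {n T : ℕ} {y : ℕ → ℕ} (hend : y 1 + y n = T)
    (h : ∀ j, 1 ≤ j → j < n → y j + y (j + 1) + y (n + 1 - j) + y (n - j) = 2 * T)
    {j : ℕ} (hj : 1 ≤ j) (hjn : j ≤ n) : y j + y (n + 1 - j) = T := by
  induction j, hj using Nat.le_induction with
  | base => simpa using hend
  | succ k hk ih =>
    have h1 := ih (by omega)
    have h2 := h k hk hjn
    rw [Nat.add_sub_add_right]
    omega

/-- A labeling by `1, …, mn` whose reflected entries have constant sum has sum `mn + 1`. -/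
lemma reflect_sum_eq {m n T : ℕ} (hmn : 0 < m * n) {x : ℕ × ℕ → ℕ}
    (hbij : Set.BijOn x (Set.Icc 1 m ×ˢ Set.Icc 1 n) (Set.Icc 1 (m * n)))
    (h : ∀ i j, 1 ≤ i → i ≤ m → 1 ≤ j → j ≤ n → x (i, j) + x (i, n + 1 - j) = T) :
    T = m * n + 1 := by
  have hmem : ∀ p : ℕ × ℕ, p ∈ Finset.Icc 1 m ×ˢ Finset.Icc 1 n ↔
      p ∈ Set.Icc 1 m ×ˢ Set.Icc 1 n := fun p => by
    simp only [Finset.mem_product, Finset.mem_Icc, Set.mem_prod, Set.mem_Icc]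
  have hsum : ∑ p ∈ Finset.Icc 1 m ×ˢ Finset.Icc 1 n, x p =
      ∑ k ∈ Finset.Icc 1 (m * n), k := by
    refine Finset.sum_bij (fun p _ => x p) ?_ ?_ ?_ (fun _ _ => rfl)
    · intro p hp
      simpa using hbij.mapsTo ((hmem p).1 hp)
    · intro p hp q hq hpq
      exact hbij.injOn ((hmem p).1 hp) ((hmem q).1 hq) hpq
    · intro k hk
      obtain ⟨p, hp, hpk⟩ := hbij.surjOn (show k ∈ Set.Icc 1 (m * n) by simpa using hk)
      exact ⟨p, (hmem p).2 hp, hpk⟩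
  have hrefl : ∑ p ∈ Finset.Icc 1 m ×ˢ Finset.Icc 1 n, x (p.1, n + 1 - p.2) =
      ∑ p ∈ Finset.Icc 1 m ×ˢ Finset.Icc 1 n, x p := by
    refine Finset.sum_nbij' (fun p => (p.1, n + 1 - p.2)) (fun p => (p.1, n + 1 - p.2))
      ?_ ?_ ?_ ?_ (fun _ _ => rfl) <;>
    · rintro ⟨i, j⟩ hp
      simp only [Finset.mem_product, Finset.mem_Icc, Prod.mk.injEq, true_and] at hp ⊢
      omega
  have htotal : ∑ p ∈ Finset.Icc 1 m ×ˢ Finset.Icc 1 n, (x p + x (p.1, n + 1 - p.2)) =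
      m * n * T := by
    rw [Finset.sum_congr rfl (g := fun _ => T)]
    · simp
    · rintro ⟨i, j⟩ hp
      simp only [Finset.mem_product, Finset.mem_Icc] at hp
      exact h i j hp.1.1 hp.1.2 hp.2.1 hp.2.2
  have hgauss : (∑ k ∈ Finset.Icc 1 (m * n), k) * 2 = m * n * (m * n + 1) := by
    have hg := Finset.sum_range_id_mul_two (m * n + 1)
    rw [Finset.sum_range_eq_add_Ico _ (Nat.succ_pos _)] at hg
    rw [show Finset.Icc 1 (m * n) = Finset.Ico 1 (m * n + 1) from rfl]
    simpa [mul_comm] using hg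
  rw [Finset.sum_add_distrib, hrefl, hsum, ← mul_two, hgauss] at htotal
  exact (Nat.eq_of_mul_eq_mul_left hmn htotal).symm

/-- If consecutive values of a sequence have constant sum, then the odd-indexed ones agree. -/
lemma odd_index_eq {m S : ℕ} {s : ℕ → ℕ} (h : ∀ i, 1 ≤ i → i + 1 ≤ m → s i + s (i + 1) = S)
    {k : ℕ} (hk : 2 * k + 1 ≤ m) : s (2 * k + 1) = s 1 := by
  induction k with
  | zero => rfl
  | succ k ih =>
    have h1 := ih (by omega)
    have h2 := h (2 * k + 1) (by omega) (by omega)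
    have h3 := h (2 * k + 2) (by omega) (by omega)
    rw [show 2 * (k + 1) + 1 = 2 * k + 2 + 1 by ring]
    rw [show 2 * k + 1 + 1 = 2 * k + 2 by ring] at h2
    omega


/-- For `m ≥ 3` odd and `n ≥ 4` even, a bijection
`x : {1,…,m} × {1,…,n} → {1,…,mn}` is a C₄-face-magic Klein bottle labeling on `𝒦_{m,n}`
(with value `S = 2(mn+1)`, so `S/2 = mn+1`) iff conditions (i)–(iv) hold, where
`a_j = x_{1,j} + x_{1,j+1}`. -/
theorem kleinBottle_magic_iff_rowConditions (m n : ℕ) (hm : 3 ≤ m) (hmo : Odd m)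
    (hn : 4 ≤ n) (hne : Even n) (x : ℕ × ℕ → ℕ)
    (hbij : Set.BijOn x (Set.Icc 1 m ×ˢ Set.Icc 1 n) (Set.Icc 1 (m * n))) :
    (∃ S, IsC4FaceMagic m n x S) ↔
      ((∀ i j, 1 ≤ i → i ≤ (m + 1) / 2 → 1 ≤ j → j ≤ n / 2 - 1 →
          x (2 * i - 1, j) + x (2 * i - 1, j + 1) = x (1, j) + x (1, j + 1)) ∧
       (∀ i j, 1 ≤ i → i ≤ (m + 1) / 2 → 1 ≤ j → j ≤ n / 2 →
          x (2 * i - 1, n + 1 - j) = (m * n + 1) - x (2 * i - 1, j)) ∧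
       (∀ i j, 1 ≤ i → i ≤ (m - 1) / 2 → 1 ≤ j → j ≤ n / 2 - 1 →
          x (2 * i, n - j) + x (2 * i, n - j + 1) = x (1, j) + x (1, j + 1)) ∧
       (∀ i j, 1 ≤ i → i ≤ (m - 1) / 2 → 1 ≤ j → j ≤ n / 2 →
          x (2 * i, j) = (m * n + 1) - x (2 * i, n + 1 - j))) := by
  obtain ⟨p, rfl⟩ := hmo
  obtain ⟨q, rfl⟩ : ∃ q, n = 2 * q := hne.two_dvd
  set m := 2 * p + 1 with hm_def
  set n := 2 * q with hn_def
  have hrange : ∀ i j, 1 ≤ i → i ≤ m → 1 ≤ j → j ≤ n → x (i, j) ≤ m * n := fun i j hi him hj hjn =>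
    (hbij.mapsTo (show (i, j) ∈ Set.Icc 1 m ×ˢ Set.Icc 1 n from ⟨⟨hi, him⟩, hj, hjn⟩)).2
  constructor
  · rintro ⟨S, hS⟩
    obtain ⟨hface, hface', hseam, hseam'⟩ := (isC4FaceMagic_iff (by omega) hbij).1 hS
    have hodd : ∀ k j, 2 * k + 1 ≤ m → 1 ≤ j → j < n →
        x (2 * k + 1, j) + x (2 * k + 1, j + 1) = x (1, j) + x (1, j + 1) :=
      fun k j hk hj hjn => odd_index_eq (S := S) (s := fun i => x (i, j) + x (i, j + 1))
        (fun i hi him => by have := hface i j hi him hj hjn; omega) hk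
    have hodd' : ∀ k, 2 * k + 1 ≤ m → x (2 * k + 1, 1) + x (2 * k + 1, n) = x (1, 1) + x (1, n) :=
      fun k hk => odd_index_eq (S := S) (s := fun i => x (i, 1) + x (i, n))
        (fun i hi him => by have := hface' i hi him; omega) hk
    have hT : 2 * (x (1, 1) + x (1, n)) = S := by
      have := hodd' p le_rfl
      rw [← hm_def] at this
      omega
    have hrow : ∀ j, 1 ≤ j → j < n →
        x (1, j) + x (1, j + 1) + x (1, n + 1 - j) + x (1, n - j) = S := fun j hj hjn => by
      have h1 := hodd p j le_rfl hj hjn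
      have h2 := hseam j hj hjn
      rw [← hm_def] at h1
      omega
    have hrefl : ∀ i j, 1 ≤ i → i ≤ m → 1 ≤ j → j ≤ n →
        x (i, j) + x (i, n + 1 - j) = x (1, 1) + x (1, n) := by
      intro i j hi him hj hjn
      obtain ⟨k, rfl | rfl⟩ : ∃ k, i = 2 * k + 1 ∨ i = 2 * k + 1 + 1 := ⟨(i - 1) / 2, by omega⟩
      · refine add_reflect_eq (y := fun j => x (2 * k + 1, j)) (hodd' k him) ?_ hj hjn
        intro j hj hjn
        have h1 := hodd k j him hj hjn
        have h2 := hodd k (n - j) him (by omega) (by omega)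
        have h3 := hrow j hj hjn
        rw [show n - j + 1 = n + 1 - j by omega] at h2
        omega
      · refine add_reflect_eq (y := fun j => x (2 * k + 1 + 1, j)) ?_ ?_ hj hjn
        · have h1 := hodd' k (by omega)
          have h2 := hface' (2 * k + 1) (by omega) him
          omega
        intro j hj hjn
        have h1 := hodd k j (by omega) hj hjn
        have h2 := hodd k (n - j) (by omega) (by omega) (by omega)
        have h3 := hrow j hj hjn
        have h4 := hface (2 * k + 1) j (by omega) him hj hjn
        have h5 := hface (2 * k + 1) (n - j) (by omega) him (by omega) (by omega)
        rw [show n - j + 1 = n + 1 - j by omega] at h2 h5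
        omega
    have hval := reflect_sum_eq (by positivity) hbij hrefl
    rw [hval] at hrefl
    refine ⟨fun i j hi hi' hj hj' => ?_, fun i j hi hi' hj hj' => ?_,
      fun i j hi hi' hj hj' => ?_, fun i j hi hi' hj hj' => ?_⟩
    · have := hodd (i - 1) j (by omega) hj (by omega)
      rwa [show 2 * (i - 1) + 1 = 2 * i - 1 by omega] at this
    · have := hrefl (2 * i - 1) j (by omega) (by omega) hj (by omega)
      omega
    · have h1 := hodd (i - 1) (n - j) (by omega) (by omega) (by omega)
      have h2 := hface (2 * (i - 1) + 1) (n - j) (by omega) (by omega) (by omega) (by omega)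
      have h3 := hrow j hj (by omega)
      rw [show n - j + 1 = n + 1 - j by omega] at h1 h2 ⊢
      rw [show 2 * (i - 1) + 1 + 1 = 2 * i by omega] at h2
      omega
    · have := hrefl (2 * i) j (by omega) (by omega) hj (by omega)
      omega
  · rintro ⟨h1, h2, h3, h4⟩
    have hhalf : ∀ i j, 1 ≤ i → i ≤ m → 1 ≤ j → j ≤ q →
        x (i, j) + x (i, n + 1 - j) = m * n + 1 := by
      intro i j hi him hj hjq
      have hl := hrange i j hi him hj (by omega)
      have hr := hrange i (n + 1 - j) hi him (by omega) (by omega)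
      obtain ⟨k, hk, rfl | rfl⟩ : ∃ k, 1 ≤ k ∧ (i = 2 * k - 1 ∨ i = 2 * k) :=
        ⟨(i + 1) / 2, by omega, by omega⟩
      · have := h2 k j hk (by omega) hj (by omega)
        omega
      · have := h4 k j hk (by omega) hj (by omega)
        omega
    have hrefl : ∀ i j, 1 ≤ i → i ≤ m → 1 ≤ j → j ≤ n →
        x (i, j) + x (i, n + 1 - j) = m * n + 1 := by
      intro i j hi him hj hjn
      rcases le_or_gt j q with hjq | hjq
      · exact hhalf i j hi him hj hjq
      · have := hhalf i (n + 1 - j) hi him (by omega) (by omega)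
        rw [show n + 1 - (n + 1 - j) = j by omega] at this
        omega
    have hodd : ∀ k j, 1 ≤ k → 2 * k - 1 ≤ m → 1 ≤ j → j < n →
        x (2 * k - 1, j) + x (2 * k - 1, j + 1) = x (1, j) + x (1, j + 1) := by
      intro k j hk hkm hj hjn
      rcases lt_or_ge j q with hjq | hjq
      · exact h1 k j hk (by omega) hj (by omega)
      have r1 := hrefl (2 * k - 1) j (by omega) hkm hj hjn.le
      have r2 := hrefl (2 * k - 1) (j + 1) (by omega) hkm (by omega) hjn
      have r3 := hrefl 1 j le_rfl (by omega) hj hjn.le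
      have r4 := hrefl 1 (j + 1) le_rfl (by omega) (by omega) hjn
      rw [Nat.add_sub_add_right] at r2 r4
      rcases hjq.eq_or_lt with rfl | hjq
      · rw [show n + 1 - q = q + 1 by omega] at r1 r3
        omega
      · have := h1 k (n - j) hk (by omega) (by omega) (by omega)
        rw [show n - j + 1 = n + 1 - j by omega] at this
        omega
    have heven : ∀ k j, 1 ≤ k → 2 * k ≤ m → 1 ≤ j → j < n →
        x (2 * k, j) + x (2 * k, j + 1) + (x (1, j) + x (1, j + 1)) = 2 * (m * n + 1) := by
      intro k j hk hkm hj hjn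
      have r1 := hrefl (2 * k) j (by omega) hkm hj hjn.le
      have r2 := hrefl (2 * k) (j + 1) (by omega) hkm (by omega) hjn
      have r3 := hrefl 1 j le_rfl (by omega) hj hjn.le
      have r4 := hrefl 1 (j + 1) le_rfl (by omega) (by omega) hjn
      rw [Nat.add_sub_add_right] at r2 r4
      rcases lt_trichotomy j q with hjq | rfl | hjq
      · have := h3 k j hk (by omega) hj (by omega)
        rw [show n - j + 1 = n + 1 - j by omega] at this
        omega
      · rw [show n + 1 - j = j + 1 by omega] at r1 r3
        omega
      · have := h3 k (n - j) hk (by omega) (by omega) (by omega)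
        rw [show n - (n - j) = j by omega, show n - j + 1 = n + 1 - j by omega] at this
        omega
    have hend : ∀ i, 1 ≤ i → i ≤ m → x (i, 1) + x (i, n) = m * n + 1 := fun i hi him => by
      simpa using hrefl i 1 hi him le_rfl (by omega)
    refine ⟨2 * (m * n + 1), (isC4FaceMagic_iff (by omega) hbij).2
      ⟨fun i j hi him hj hjn => ?_, fun i hi him => ?_, fun j hj hjn => ?_, ?_⟩⟩
    · obtain ⟨k, hk, rfl | rfl⟩ : ∃ k, 1 ≤ k ∧ (i = 2 * k - 1 ∨ i = 2 * k) :=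
        ⟨(i + 1) / 2, by omega, by omega⟩
      · have e1 := hodd k j hk (by omega) hj hjn
        have e2 := heven k j hk (by omega) hj hjn
        rw [show 2 * k - 1 + 1 = 2 * k by omega]
        omega
      · have e1 := hodd (k + 1) j (by omega) (by omega) hj hjn
        have e2 := heven k j hk (by omega) hj hjn
        rw [show 2 * (k + 1) - 1 = 2 * k + 1 by omega] at e1
        omega
    · have e1 := hend i hi (by omega)
      have e2 := hend (i + 1) (by omega) him
      omega
    · have e1 := hodd (p + 1) j (by omega) (by omega) hj hjn
      rw [show 2 * (p + 1) - 1 = m by omega] at e1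
      have r3 := hrefl 1 j le_rfl (by omega) hj hjn.le
      have r4 := hrefl 1 (j + 1) le_rfl (by omega) (by omega) hjn
      rw [Nat.add_sub_add_right] at r4
      omega
    · have e1 := hend m (by omega) le_rfl
      have e2 := hend 1 le_rfl (by omega)
      omega
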